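/- Suppose all μ_{kℓ} equal a common constant μ ≥ 1 for (k,ℓ) ∈ E(P), |λ_j| = λ_s > 0 for all j ∈ P_S, and |λ_k| = λ_u > 0 for all k ∈ P_U. Suppose there exist T_0 ≥ 0 and ρ ∈ [0, λ_s/(λ_s+λ_u)) with Σ_{k∈P_U} T_k(s,t) ≤ T_0 + ρ(t−s) for every 0 ≤ s < t, and suppose σ satisfies an average dwell time: there exist N_0 > 0 and τ_a > (ln μ)/(λ_s(1−ρ) − λ_u ρ) with N(s,t) ≤ N_0 + (t−s)/τ_a for every 0 ≤ s < t. Then condition (★) holds: limsup_{t→+∞} ( ν(t) · Σ_{(k,ℓ)∈E(P)} (ln μ_{kℓ}) ρ_{kℓ}(t) − Σ_{j∈P_S} |λ_j| η_j(t) + Σ_{k∈P_U} |λ_k| η_k(t) ) < 0; indeed this limsup is at most (ln μ)/τ_a − λ_s(1−ρ) + λ_u ρ < 0. -/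

import Mathlib

open Filter MeasureTheory Set

noncomputable section

/-- A switching signal: strictly increasing switching instants `tau 0 = 0 < tau 1 < ...`
tending to `+∞`, together with the signal `sig` itself, constant on `[tau i, tau (i+1))`
and actually switching at each `tau (i+1)`. -/
structure SwitchSig (P : Type*) where
  tau : ℕ → ℝ
  sig : ℝ → P
  tau0 : tau 0 = 0
  mono : StrictMono tau
  tends : Filter.Tendsto tau Filter.atTop Filter.atTop
  const : ∀ i : ℕ, ∀ t : ℝ, tau i ≤ t → t < tau (i + 1) → sig t = sig (tau i)
  switch : ∀ i : ℕ, sig (tau i) ≠ sig (tau (i + 1))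

namespace SwitchSig

variable {P : Type*} (S : SwitchSig P)

/-- `N s t` : the number of switching instants in `(s, t]`. -/
def N (s t : ℝ) : ℕ := Set.ncard {i : ℕ | s < S.tau i ∧ S.tau i ≤ t}

/-- `Ntrans k l t` : the number of transitions from `k` to `l` occurring up to time `t`. -/
def Ntrans (k l : P) (t : ℝ) : ℕ :=
  Set.ncard {i : ℕ | S.tau (i + 1) ≤ t ∧ S.sig (S.tau i) = k ∧ S.sig (S.tau (i + 1)) = l}

/-- `Nmode j s t` : the number of switching instants in `(s, t]` at which subsystem `j`
is activated. -/
def Nmode (j : P) (s t : ℝ) : ℕ :=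
  Set.ncard {i : ℕ | s < S.tau i ∧ S.tau i ≤ t ∧ S.sig (S.tau i) = j}

/-- `T j s t` : the total duration of activation of subsystem `j` on `(s, t]`
(Lebesgue measure). -/
def T (j : P) (s t : ℝ) : ℝ :=
  (MeasureTheory.volume {r : ℝ | s < r ∧ r ≤ t ∧ S.sig r = j}).toReal

/-- switching frequency `ν(t) = N(0,t)/t`. -/
def nu (t : ℝ) : ℝ := (S.N 0 t : ℝ) / t

/-- transition frequency `ρ_{kl}(t) = N_{kl}(0,t)/N(0,t)`. -/
def rho (k l : P) (t : ℝ) : ℝ := (S.Ntrans k l t : ℝ) / (S.N 0 t : ℝ)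

/-- fraction of activation `η_j(t) = T_j(0,t)/t`. -/
def eta (j : P) (t : ℝ) : ℝ := S.T j 0 t / t

end SwitchSig

namespace SwitchSig

variable {P : Type*} (S : SwitchSig P)

theorem finite_tau_le (t : ℝ) : {i : ℕ | S.tau i ≤ t}.Finite := by
  obtain ⟨n, hn⟩ := (S.tends.eventually_gt_atTop t).exists
  refine (Set.finite_lt_nat n).subset fun i hi => ?_
  by_contra h
  exact absurd (S.mono.monotone (not_lt.mp h)) (not_le.mpr (lt_of_le_of_lt hi hn))

theorem tau_succ_pos (i : ℕ) : 0 < S.tau (i + 1) :=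
  S.tau0 ▸ S.mono i.succ_pos

/-- If every transition is admissible, the admissible transitions up to `t` number `N 0 t`
at most. -/
theorem sum_Ntrans_le (E : Finset (P × P))
    (hE : ∀ i : ℕ, (S.sig (S.tau i), S.sig (S.tau (i + 1))) ∈ E) (t : ℝ) :
    ∑ p ∈ E, S.Ntrans p.1 p.2 t ≤ S.N 0 t := by
  classical
  have hfin : {i : ℕ | S.tau (i + 1) ≤ t}.Finite :=
    (S.finite_tau_le t).preimage (add_left_injective 1).injOn
  have hsum : hfin.toFinset.card = ∑ p ∈ E, S.Ntrans p.1 p.2 t := by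
    rw [Finset.card_eq_sum_card_fiberwise (t := E)
      (f := fun i => (S.sig (S.tau i), S.sig (S.tau (i + 1)))) fun i _ => hE i]
    refine Finset.sum_congr rfl fun p _ => ?_
    rw [Ntrans, ← Set.ncard_coe_finset]
    congr 1
    ext i
    simp [Prod.ext_iff]
  rw [← hsum, ← Set.ncard_eq_toFinset_card _ hfin,
    ← Set.ncard_image_of_injective _ (add_left_injective 1)]
  refine Set.ncard_le_ncard ?_ ((S.finite_tau_le t).subset fun i hi => hi.2)
  rintro _ ⟨i, hi, rfl⟩
  exact ⟨S.tau_succ_pos i, hi⟩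

theorem sum_rho_le_one (E : Finset (P × P))
    (hE : ∀ i : ℕ, (S.sig (S.tau i), S.sig (S.tau (i + 1))) ∈ E) (t : ℝ) :
    ∑ p ∈ E, S.rho p.1 p.2 t ≤ 1 := by
  simp only [rho]
  rw [← Finset.sum_div]
  exact div_le_one_of_le₀ (mod_cast S.sum_Ntrans_le E hE t) (Nat.cast_nonneg _)

/-- Modes exhausting `P` are active for a total duration of at least `t - s` on `(s, t]`. -/
theorem sub_le_sum_T (A : Finset P) (hA : ∀ i, i ∈ A) {s t : ℝ} (hst : s ≤ t) :
    t - s ≤ ∑ j ∈ A, S.T j s t := by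
  have hfin : ∀ j, volume {r : ℝ | s < r ∧ r ≤ t ∧ S.sig r = j} ≠ ⊤ := fun j =>
    measure_ne_top_of_subset (fun r hr => (⟨hr.1, hr.2.1⟩ : r ∈ Ioc s t))
      measure_Ioc_lt_top.ne
  have hcov : Ioc s t ⊆ ⋃ j ∈ A, {r : ℝ | s < r ∧ r ≤ t ∧ S.sig r = j} := fun r hr =>
    mem_biUnion (hA (S.sig r)) ⟨hr.1, hr.2, rfl⟩
  have hle := (measure_mono (μ := volume) hcov).trans (measure_biUnion_finset_le A _)
  simp only [T]
  rw [← ENNReal.toReal_sum fun j _ => hfin j, ← ENNReal.toReal_ofReal (sub_nonneg.mpr hst),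
    ← Real.volume_Ioc]
  exact ENNReal.toReal_mono (ENNReal.sum_ne_top.mpr fun j _ => hfin j) hle

end SwitchSig

/-- A function eventually bounded by `c + d / t` has upper limit at most `c` at `+∞`. -/
theorem limsup_coe_le_of_eventually_le_add_div {f : ℝ → ℝ} {c d : ℝ}
    (h : ∀ᶠ t in atTop, f t ≤ c + d / t) :
    limsup (fun t => (f t : EReal)) atTop ≤ (c : EReal) := by
  have hlim : Tendsto (fun t : ℝ => c + d / t) atTop (nhds c) := by
    simpa using (tendsto_const_nhds (x := d)).div_atTop tendsto_id |>.const_add c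
  have hlim' : Tendsto (fun t : ℝ => ((c + d / t : ℝ) : EReal)) atTop (nhds (c : EReal)) :=
    (continuous_coe_real_ereal.tendsto c).comp hlim
  rw [← hlim'.limsup_eq]
  exact limsup_le_limsup (h.mono fun t ht => EReal.coe_le_coe_iff.mpr ht)

theorem stmt8 {P : Type*}
    (S : SwitchSig P) (PS PU : Finset P) (Eadm : Finset (P × P))
    (lam : P → ℝ) (mu : P → P → ℝ)
    (hcover : ∀ i : P, i ∈ PS ∨ i ∈ PU) (hdisj : Disjoint PS PU)
    (hadm : ∀ i : ℕ, (S.sig (S.tau i), S.sig (S.tau (i + 1))) ∈ Eadm)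
    (hlamS : ∀ j ∈ PS, 0 < lam j) (hlamU : ∀ k ∈ PU, lam k < 0)
    (hmu : ∀ p ∈ Eadm, 1 ≤ mu p.1 p.2)
    (muc lams lamu : ℝ)
    (hmuc : 1 ≤ muc) (hmuconst : ∀ p ∈ Eadm, mu p.1 p.2 = muc)
    (hlams : 0 < lams) (hlamu : 0 < lamu)
    (habsS : ∀ j ∈ PS, |lam j| = lams) (habsU : ∀ k ∈ PU, |lam k| = lamu)
    (T0 ρ : ℝ) (hT0 : 0 ≤ T0) (hρ0 : 0 ≤ ρ) (hρ1 : ρ < lams / (lams + lamu))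
    (hTU : ∀ s t : ℝ, 0 ≤ s → s < t → (∑ k ∈ PU, S.T k s t) ≤ T0 + ρ * (t - s))
    (N0 taua : ℝ) (hN0 : 0 < N0) (htaua : 0 < taua)
    (htbig : Real.log muc / (lams * (1 - ρ) - lamu * ρ) < taua)
    (hADT : ∀ s t : ℝ, 0 ≤ s → s < t → (S.N s t : ℝ) ≤ N0 + (t - s) / taua) :
    Filter.limsup
        (fun t : ℝ =>
          ((S.nu t * ∑ p ∈ Eadm, Real.log (mu p.1 p.2) * S.rho p.1 p.2 t
              - ∑ j ∈ PS, |lam j| * S.eta j t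
              + ∑ k ∈ PU, |lam k| * S.eta k t : ℝ) : EReal))
        Filter.atTop
      ≤ ((Real.log muc / taua - lams * (1 - ρ) + lamu * ρ : ℝ) : EReal) ∧
    Real.log muc / taua - lams * (1 - ρ) + lamu * ρ < 0 := by
  have hlog : 0 ≤ Real.log muc := Real.log_nonneg hmuc
  have hdecay : 0 < lams * (1 - ρ) - lamu * ρ := by
    rw [lt_div_iff₀ (by positivity)] at hρ1
    linarith
  refine ⟨?_, ?_⟩
  swap
  · have : Real.log muc / taua < lams * (1 - ρ) - lamu * ρ := by
      rw [div_lt_iff₀ hdecay] at htbig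
      rwa [div_lt_iff₀' htaua]
    linarith
  refine limsup_coe_le_of_eventually_le_add_div
    (d := Real.log muc * N0 + (lams + lamu) * T0) ?_
  filter_upwards [eventually_gt_atTop 0] with t ht
  have hjump : S.nu t * ∑ p ∈ Eadm, Real.log (mu p.1 p.2) * S.rho p.1 p.2 t
      ≤ Real.log muc * (N0 / t + 1 / taua) := by
    have hnu : S.nu t ≤ N0 / t + 1 / taua := by
      have := hADT 0 t le_rfl ht
      rw [SwitchSig.nu, div_le_iff₀ ht]
      calc (S.N 0 t : ℝ) ≤ N0 + (t - 0) / taua := this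
        _ = (N0 / t + 1 / taua) * t := by field_simp; ring
    have hnu0 : 0 ≤ S.nu t := div_nonneg (Nat.cast_nonneg _) ht.le
    rw [Finset.sum_congr rfl fun p hp => by rw [hmuconst p hp], ← Finset.mul_sum]
    calc S.nu t * (Real.log muc * ∑ p ∈ Eadm, S.rho p.1 p.2 t)
        ≤ S.nu t * (Real.log muc * 1) := by
          gcongr
          exact S.sum_rho_le_one Eadm hadm t
      _ = Real.log muc * S.nu t := by ring
      _ ≤ _ := by gcongr
  have hS : ∑ j ∈ PS, |lam j| * S.eta j t = lams * ((∑ j ∈ PS, S.T j 0 t) / t) := by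
    rw [Finset.sum_div, Finset.mul_sum]
    exact Finset.sum_congr rfl fun j hj => by rw [habsS j hj, SwitchSig.eta]
  have hU : ∑ k ∈ PU, |lam k| * S.eta k t = lamu * ((∑ k ∈ PU, S.T k 0 t) / t) := by
    rw [Finset.sum_div, Finset.mul_sum]
    exact Finset.sum_congr rfl fun k hk => by rw [habsU k hk, SwitchSig.eta]
  have hUle : (∑ k ∈ PU, S.T k 0 t) / t ≤ T0 / t + ρ := by
    rw [div_le_iff₀ ht, add_mul, div_mul_cancel₀ _ ht.ne']
    simpa using hTU 0 t le_rfl ht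
  have hSge : 1 - (∑ k ∈ PU, S.T k 0 t) / t ≤ (∑ j ∈ PS, S.T j 0 t) / t := by
    classical
    have hsum := S.sub_le_sum_T (PS ∪ PU) (fun i => Finset.mem_union.mpr (hcover i)) ht.le
    rw [Finset.sum_union hdisj, sub_zero] at hsum
    rw [sub_le_iff_le_add, ← add_div, le_div_iff₀ ht, one_mul]
    exact hsum
  rw [hS, hU]
  calc _ ≤ Real.log muc * (N0 / t + 1 / taua)
        - lams * (1 - (∑ k ∈ PU, S.T k 0 t) / t)
        + lamu * ((∑ k ∈ PU, S.T k 0 t) / t) := by gcongr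
    _ = Real.log muc * (N0 / t + 1 / taua) - lams
        + (lams + lamu) * ((∑ k ∈ PU, S.T k 0 t) / t) := by ring
    _ ≤ Real.log muc * (N0 / t + 1 / taua) - lams + (lams + lamu) * (T0 / t + ρ) := by
        gcongr
    _ = _ := by ring
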